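/- Let D ≥ 0 be an integer, S ⊆ ℂ a finite set, and f : ℂ \ S → ℂ a holomorphic function. Suppose there exist sequences of polynomials (p_n) and (q_n) with complex coefficients, with each q_n monic, deg p_n ≤ D and deg q_n ≤ D, such that for every compact K ⊆ ℂ \ S there is N with: for all n ≥ N, q_n has no zeros in K and sup_{z ∈ K} |p_n(z)/q_n(z) − f(z)| → 0 as n → ∞. Then there exist polynomials p and q with q not identically zero, deg p ≤ D and deg q ≤ D, such that f(z) = p(z)/q(z) for all z ∈ ℂ \ S with q(z) ≠ 0; in particular f extends to a rational function of degree at most D. -/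

import Mathlib

open Polynomial Filter Topology in
/-- If `pₙ z / qₙ z` converges to `f z` at every point of an infinite set, where `pₙ, qₙ` have
degree at most `D` and `qₙ ≠ 0` has eventually no zero at `z`, then `P = f Q` on that set for
some polynomials `P` and `Q ≠ 0` of degree at most `D`. -/
theorem exists_polynomial_eval_eq_mul_of_tendsto_div {D : ℕ} {U : Set ℂ} (hU : U.Infinite)
    {f : ℂ → ℂ} {p q : ℕ → ℂ[X]} (hq : ∀ n, q n ≠ 0)
    (hpD : ∀ n, (p n).natDegree ≤ D) (hqD : ∀ n, (q n).natDegree ≤ D)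
    (hne : ∀ z ∈ U, ∀ᶠ n in atTop, (q n).eval z ≠ 0)
    (hlim : ∀ z ∈ U, Tendsto (fun n => (p n).eval z / (q n).eval z) atTop (𝓝 (f z))) :
    ∃ P Q : ℂ[X], Q ≠ 0 ∧ P.natDegree ≤ D ∧ Q.natDegree ≤ D ∧
      ∀ z ∈ U, P.eval z = f z * Q.eval z := by
  classical
  let w : ℕ → (Fin (D + 1) → ℂ) × (Fin (D + 1) → ℂ) :=
    fun n => (toFn (D + 1) (p n), toFn (D + 1) (q n))
  have hwp (n) : ofFn (D + 1) (w n).1 = p n :=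
    ofFn_comp_toFn_eq_id_of_natDegree_lt (Nat.lt_succ_of_le (hpD n))
  have hwq (n) : ofFn (D + 1) (w n).2 = q n :=
    ofFn_comp_toFn_eq_id_of_natDegree_lt (Nat.lt_succ_of_le (hqD n))
  have hw (n) : w n ≠ 0 := fun h => hq n (by rw [← hwq n, h]; simp)
  have hmem (n) : ((‖w n‖ : ℂ)⁻¹ • w n) ∈ Metric.sphere
      (0 : (Fin (D + 1) → ℂ) × (Fin (D + 1) → ℂ)) 1 := by
    rw [mem_sphere_zero_iff_norm]
    simpa using norm_smul_inv_norm (𝕜 := ℂ) (hw n)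
  obtain ⟨v, hv, φ, hφ, hvlim⟩ := (isCompact_sphere _ _).tendsto_subseq hmem
  have hcont (z : ℂ) : Continuous fun u : Fin (D + 1) → ℂ => (ofFn (D + 1) u).eval z :=
    LinearMap.continuous_of_finiteDimensional (leval z ∘ₗ ofFn (D + 1))
  have hP (z : ℂ) : Tendsto (fun n => (‖w (φ n)‖ : ℂ)⁻¹ * (p (φ n)).eval z) atTop
      (𝓝 ((ofFn (D + 1) v.1).eval z)) := by
    simpa [Function.comp_def, hwp] using
      (((hcont z).comp continuous_fst).tendsto v).comp hvlim
  have hQ (z : ℂ) : Tendsto (fun n => (‖w (φ n)‖ : ℂ)⁻¹ * (q (φ n)).eval z) atTop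
      (𝓝 ((ofFn (D + 1) v.2).eval z)) := by
    simpa [Function.comp_def, hwq] using
      (((hcont z).comp continuous_snd).tendsto v).comp hvlim
  have key : ∀ z ∈ U, (ofFn (D + 1) v.1).eval z = f z * (ofFn (D + 1) v.2).eval z := by
    intro z hz
    refine tendsto_nhds_unique (hP z)
      ((((hlim z hz).comp hφ.tendsto_atTop).mul (hQ z)).congr' ?_)
    filter_upwards [hφ.tendsto_atTop.eventually (hne z hz)] with n hn
    simp only [Function.comp_apply]
    field_simp
  refine ⟨ofFn (D + 1) v.1, ofFn (D + 1) v.2, fun h0 => ?_,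
    Nat.le_of_lt_succ (ofFn_natDegree_lt (Nat.succ_pos D) _),
    Nat.le_of_lt_succ (ofFn_natDegree_lt (Nat.succ_pos D) _), key⟩
  have h1 : ofFn (D + 1) v.1 = 0 := eq_zero_of_infinite_isRoot _
    (hU.mono fun z hz => by simp [IsRoot.def, key z hz, h0])
  have hv0 : v = 0 := Prod.ext (injective_ofFn _ (h1.trans (map_zero _).symm))
    (injective_ofFn _ (h0.trans (map_zero _).symm))
  simp [hv0] at hv


/-- a holomorphic function on the complement of a finite set which
is a normal limit of rational functions `pₙ/qₙ` of uniformly bounded degree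
(`qₙ` monic, eventually zero-free on each compact) is itself a rational
function of degree at most `D`. -/
theorem limit_of_bounded_degree_rationals_is_rational (D : ℕ) (S : Set ℂ)
    (hS : S.Finite) (f : ℂ → ℂ) (hf : DifferentiableOn ℂ f Sᶜ)
    (p q : ℕ → Polynomial ℂ) (hq : ∀ n, (q n).Monic)
    (hpD : ∀ n, (p n).natDegree ≤ D) (hqD : ∀ n, (q n).natDegree ≤ D)
    (hconv : ∀ K : Set ℂ, K ⊆ Sᶜ → IsCompact K →
      (∃ N : ℕ, ∀ n : ℕ, N ≤ n → ∀ z ∈ K, (q n).eval z ≠ 0) ∧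
      TendstoUniformlyOn (fun n z => (p n).eval z / (q n).eval z) f
        Filter.atTop K) :
    ∃ P Q : Polynomial ℂ, Q ≠ 0 ∧ P.natDegree ≤ D ∧ Q.natDegree ≤ D ∧
      ∀ z : ℂ, z ∉ S → Q.eval z ≠ 0 → f z = P.eval z / Q.eval z := by
  obtain ⟨P, Q, hQ, hPD, hQD, h⟩ := exists_polynomial_eval_eq_mul_of_tendsto_div
    hS.infinite_compl (fun n => (hq n).ne_zero) hpD hqD
    (fun z hz => by
      obtain ⟨N, hN⟩ := (hconv {z} (by simpa using hz) isCompact_singleton).1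
      exact Filter.eventually_atTop.2 ⟨N, fun n hn => hN n hn z rfl⟩)
    (fun z hz => (hconv {z} (by simpa using hz) isCompact_singleton).2.tendsto_at rfl)
  exact ⟨P, Q, hQ, hPD, hQD, fun z hz hQz => eq_div_of_mul_eq hQz (h z hz).symm⟩
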